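/- arXiv:1811.10841 — 6 statements merged into one kernel-verified Lean document; each statement's English description precedes it below -/
import Mathlib

section
/- For every real number X with X > 0 and X ≠ 1, one has (5X⁴ − 4X³ + 62X² − 4X + 5)/(X(X−1)²) ≠ 20. -/
theorem typeD_norm_ne_twenty :
    ∀ X : ℝ, 0 < X → X ≠ 1 →
      (5*X^4 - 4*X^3 + 62*X^2 - 4*X + 5) / (X*(X-1)^2) ≠ 20 := by
  intro X hX hX1 h
  have hden : X * (X - 1) ^ 2 ≠ 0 :=
    mul_ne_zero hX.ne' (pow_ne_zero 2 (sub_ne_zero.mpr hX1))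
  rw [div_eq_iff hden] at h
  nlinarith [sq_nonneg (5 * (X ^ 2 + 1) - 12 * X), pow_pos hX 2]
end

section
/- For every real number X with X > 0 and X ≠ 1, one has 3(3X⁴ − 2X³ + 30X² − 2X + 3)/(X(X−1)²) − 2 ≠ 32. -/
theorem typeE_norm_ne_thirtytwo :
    ∀ X : ℝ, 0 < X → X ≠ 1 →
      3*(3*X^4 - 2*X^3 + 30*X^2 - 2*X + 3) / (X*(X-1)^2) - 2 ≠ 32 := by
  intro X hX hX1 h
  have hden : X * (X - 1) ^ 2 ≠ 0 :=
    mul_ne_zero hX.ne' (pow_ne_zero 2 (sub_ne_zero.mpr hX1))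
  rw [sub_eq_iff_eq_add, div_eq_iff hden] at h
  nlinarith [sq_nonneg (3 * X ^ 2 - 20 / 3 * X + 3), pow_pos hX 2]
end

section
/- Let n and m be integers with n ≥ 2 and 0 ≤ m ≤ n−2, and let r be a real number with 0 < r < π/2. Then 2(n−m−1)·cot²r + 2m·tan²r + (cot r − tan r)² = 2(n+1) holds if and only if cot²r = (n+2+√((2m−n+1)²+4(n+1)))/(2n−2m−1) or cot²r = (n+2−√((2m−n+1)²+4(n+1)))/(2n−2m−1). -/
open Real

theorem biharmonic_tube_condition (n m : ℤ) (hn : 2 ≤ n) (hm0 : 0 ≤ m)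
    (hmn : m ≤ n - 2) (r : ℝ) (hr0 : 0 < r) (hr : r < π/2) :
    2*((n : ℝ) - m - 1)*(Real.cot r)^2 + 2*(m : ℝ)*(Real.tan r)^2
        + (Real.cot r - Real.tan r)^2 = 2*((n : ℝ)+1) ↔
      (Real.cot r)^2
          = ((n : ℝ)+2 + Real.sqrt ((2*(m : ℝ)-n+1)^2 + 4*((n : ℝ)+1)))/(2*(n : ℝ)-2*m-1) ∨
        (Real.cot r)^2
          = ((n : ℝ)+2 - Real.sqrt ((2*(m : ℝ)-n+1)^2 + 4*((n : ℝ)+1)))/(2*(n : ℝ)-2*m-1) := by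
  have hc : 0 < Real.cot r := by
    rw [Real.cot_eq_cos_div_sin]
    exact div_pos (Real.cos_pos_of_mem_Ioo ⟨by linarith, hr⟩)
      (Real.sin_pos_of_pos_of_lt_pi hr0 (by linarith))
  have ht : Real.tan r = (Real.cot r)⁻¹ := by
    rw [Real.cot_eq_cos_div_sin, Real.tan_eq_sin_div_cos, inv_div]
  have hn' : (2 : ℝ) ≤ n := by exact_mod_cast hn
  have hmn' : (m : ℝ) ≤ n - 2 := by exact_mod_cast hmn
  have ha : 0 < 2*(n : ℝ)-2*m-1 := by linarith
  have hs := Real.sq_sqrt (show 0 ≤ (2*(m : ℝ)-n+1)^2 + 4*((n : ℝ)+1) by positivity)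
  rw [ht]
  generalize Real.sqrt ((2*(m : ℝ)-n+1)^2 + 4*((n : ℝ)+1)) = s at *
  generalize Real.cot r = c at *
  have hquad : 2*((n : ℝ) - m - 1)*c^2 + 2*(m : ℝ)*(c⁻¹)^2 + (c - c⁻¹)^2 = 2*((n : ℝ)+1) ↔
      (2*(n : ℝ)-2*m-1)*(c^2)^2 - 2*(n+2)*c^2 + (2*m+1) = 0 := by
    have hmul : (2*(n : ℝ)-2*m-1)*(c^2)^2 - 2*(n+2)*c^2 + (2*m+1) =
        c^2 * (2*((n : ℝ) - m - 1)*c^2 + 2*(m : ℝ)*(c⁻¹)^2 + (c - c⁻¹)^2 - 2*((n : ℝ)+1)) := by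
      field_simp
      ring
    rw [hmul, mul_eq_zero_iff_left (pow_ne_zero 2 hc.ne'), sub_eq_zero]
  have hfactor : (2*(n : ℝ)-2*m-1) * ((2*(n : ℝ)-2*m-1)*(c^2)^2 - 2*(n+2)*c^2 + (2*m+1)) =
      (c^2*(2*(n : ℝ)-2*m-1) - (n+2+s)) * (c^2*(2*(n : ℝ)-2*m-1) - (n+2-s)) := by
    linear_combination hs
  rw [hquad, eq_div_iff ha.ne', eq_div_iff ha.ne', ← mul_eq_zero_iff_left ha.ne', hfactor,
    mul_eq_zero, sub_eq_zero, sub_eq_zero]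
end

section
/- Let r be a real number with 0 < r < π/2. Then 2·cot²r + (cot r − tan r)² = 6 holds if and only if cot²r = (4+√13)/3 or cot²r = (4−√13)/3, and both of these values are strictly positive. -/
open Real

theorem biharmonic_geodesic_sphere_CP2 (r : ℝ) (hr0 : 0 < r) (hr : r < π/2) :
    (2*(Real.cot r)^2 + (Real.cot r - Real.tan r)^2 = 6 ↔
      (Real.cot r)^2 = (4 + Real.sqrt 13)/3 ∨ (Real.cot r)^2 = (4 - Real.sqrt 13)/3) ∧
    0 < (4 + Real.sqrt 13)/3 ∧ 0 < (4 - Real.sqrt 13)/3 := by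
  have ht : 0 < Real.tan r := Real.tan_pos_of_pos_of_lt_pi_div_two hr0 hr
  have hcot : Real.cot r = (Real.tan r)⁻¹ := (Real.tan_inv_eq_cot r).symm
  have hc : 0 < Real.cot r := hcot ▸ inv_pos.mpr ht
  have htan : Real.tan r = (Real.cot r)⁻¹ := by rw [hcot, inv_inv]
  have hs : Real.sqrt 13 ^ 2 = 13 := Real.sq_sqrt (by norm_num)
  have hs4 : Real.sqrt 13 < 4 := by
    rw [Real.sqrt_lt' (by norm_num)]
    norm_num
  refine ⟨?_, by positivity, by linarith⟩
  rw [htan]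
  generalize Real.cot r = c at hc
  have hquad : 2 * c ^ 2 + (c - c⁻¹) ^ 2 = 6 ↔ 3 * (c ^ 2) ^ 2 - 8 * c ^ 2 + 1 = 0 := by
    field_simp
    constructor <;> intro h <;> linarith
  have hfactor : 3 * (c ^ 2) ^ 2 - 8 * c ^ 2 + 1 =
      3 * ((c ^ 2 - (4 + Real.sqrt 13) / 3) * (c ^ 2 - (4 - Real.sqrt 13) / 3)) := by
    linear_combination (1 / 3) * hs
  rw [hquad, hfactor, mul_eq_zero_iff_left (by norm_num), mul_eq_zero, sub_eq_zero, sub_eq_zero]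
end

section
/- Let α, β, γ be real numbers satisfying 4α² − 9β² + 17αγ + 4γ² = 0 and 54β⁴ − (49α² + 209αγ + 52γ² − 54)β² − 32γ⁴ − 44αγ³ + (59α² + 32)γ² + (17α³ + 76α)γ + 17α² = 0. Then (α + 4γ)·(100γ³ + 300αγ² + (300α² − 126)γ + 100α³ − 369α) = 0. -/
theorem eliminate_beta (α β γ : ℝ)
    (h1 : 4*α^2 - 9*β^2 + 17*α*γ + 4*γ^2 = 0)
    (h2 : 54*β^4 - (49*α^2 + 209*α*γ + 52*γ^2 - 54)*β^2
        - 32*γ^4 - 44*α*γ^3 + (59*α^2 + 32)*γ^2 + (17*α^3 + 76*α)*γ + 17*α^2 = 0) :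
    (α + 4*γ) * (100*γ^3 + 300*α*γ^2 + (300*α^2 - 126)*γ + 100*α^3 - 369*α) = 0 := by
  have hβ : β^2 = (4*α^2 + 17*α*γ + 4*γ^2) / 9 := by linarith
  have hβ4 : β^4 = ((4*α^2 + 17*α*γ + 4*γ^2) / 9)^2 := by rw [← hβ]; ring
  rw [hβ4, hβ] at h2
  linear_combination (-9) * h2
end

section
/- Let α, β, γ, d be real numbers satisfying 2α² − β² − 3αd + d² + 5αγ − 3dγ + 2γ² = 0 and 2β⁴ − {18γ² + (35α − 22d)γ + 13α² − 18αd + 6d² − 2}β² − 8γ⁴ − (6α − 10d)γ³ + (9α² − 2αd − 3d² + 8)γ² + {5α³ − 8α²d + (3d² + 14)α − 10d}γ + 5α² − 8αd + 3d² = 0. Then (α − d + 2γ)·g(α,γ) = 0, where g(α,γ) = 18γ³ + (54α − 33d)γ² + (54α² − 66αd + 20d² − 6)γ + 18α³ − 33α²d + (20d² − 9)α − 4d³ + 5d. -/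
theorem eliminate_beta_constant_mean (α β γ d : ℝ)
    (h1 : 2*α^2 - β^2 - 3*α*d + d^2 + 5*α*γ - 3*d*γ + 2*γ^2 = 0)
    (h2 : 2*β^4 - (18*γ^2 + (35*α - 22*d)*γ + 13*α^2 - 18*α*d + 6*d^2 - 2)*β^2
        - 8*γ^4 - (6*α - 10*d)*γ^3 + (9*α^2 - 2*α*d - 3*d^2 + 8)*γ^2
        + (5*α^3 - 8*α^2*d + (3*d^2 + 14)*α - 10*d)*γ + 5*α^2 - 8*α*d + 3*d^2 = 0) :
    (α - d + 2*γ) *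
      (18*γ^3 + (54*α - 33*d)*γ^2 + (54*α^2 - 66*α*d + 20*d^2 - 6)*γ
        + 18*α^3 - 33*α^2*d + (20*d^2 - 9)*α - 4*d^3 + 5*d) = 0 := by
  linear_combination -h2 + (-2*(β^2 + (2*α^2 - 3*α*d + d^2 + 5*α*γ - 3*d*γ + 2*γ^2))
    + (18*γ^2 + (35*α - 22*d)*γ + 13*α^2 - 18*α*d + 6*d^2 - 2)) * h1
end
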